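/- Let $n\in\mathbb N$, $\mathbb T^n=\mathbb R^n/\mathbb Z^n$, $\mathbb R^+=[0,+\infty)$, and let $B=B_{3/4}\subset\mathbb R^n$ be the open ball of radius $3/4$ centred at the origin. For $f:\mathbb T^n\times\mathbb R^+\times B\to\mathbb R$ write $f^t_{p_0}(\theta)=f(\theta,t;p_0)$. For an integer $k\ge 0$, $|h|_{C^k}=\sup_{|\alpha|\le k}|\partial^\alpha h|_{C^0}$, and for $\sigma=k+\mu$ with $0<\mu<1$, $|h|_{C^\sigma}=|h|_{C^k}+\sup_{|\alpha|=k,\,x\ne y}|\partial^\alpha h(x)-\partial^\alpha h(y)|/|x-y|^\mu$. Let $\mathcal P^+_\sigma$ be the space of continuous $f:\mathbb T^n\times\mathbb R^+\times B\to\mathbb R$ that are differentiable in $p_0$ at every point and satisfy $f^t_{p_0}\in C^\sigma(\mathbb T^n)$ for all $(t,p_0)$; let $\mathcal B^+_\sigma$ be the space of those $f\in\mathcal P^+_\sigma$ for which $\partial_{p_0}f$ is continuous on $\mathbb T^n\times\mathbb R^+\times B$. Put $$|f|^+_{\sigma,l}=\sup_{(t,p_0)\in\mathbb R^+\times B}|f^t_{p_0}|_{C^\sigma}(1+t^l)+\sup_{(t,p_0)\in\mathbb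 R^+\times B}|(\partial_{p_0}f)^t_{p_0}|_{C^0}(1+t^{l-1}).$$ Let $\sigma\ge 1$, $l>1$, $\omega\in C^1(B,\mathbb R^n)$, and $g\in\mathcal B^+_\sigma$ with $|g|^+_{\sigma,l+1}<\infty$. Then the integral $$\kappa(\theta,t;p_0)=-\int_t^{+\infty}g(\theta+\omega(p_0)(\tau-t),\tau;p_0)\,d\tau$$ converges absolutely for all $(\theta,t;p_0)\in\mathbb T^n\times\mathbb R^+\times B$, and $\kappa$ is the unique function in $\mathcal P^+_\sigma$ that satisfies, at every point of $\mathbb T^n\times\mathbb R^+\times B$, the homological equation $$\omega(p_0)\cdot\partial_\theta\kappa+\partial_t\kappa=g$$ (with the one-sided $t$-derivative at $t=0$) and $\lim_{t\to+\infty}|\kappa^t_{p_0}|_{C^0}=0$ for each $p_0\in B$. If $\sigma>1$, or if $\sigma=1$ and $\partial_\theta g$ is continuous on $\mathbb T^n\times\mathbb R^+\times B$, then $\kappa\in\mathcal B^+_\sigma$ (so $\kappa$ is also the unique such solution in $\mathcal B^+_\sigma$). Moreover, for every $\sigma\ge1$, if $|\omega|_{C^1}<\infty$, then $$|\kappa|^+_{\sigma,l}\le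 C(n,l,|\omega|_{C^1})\,|g|^+_{\sigma,l+1}$$ for a constant $C(n,l,|\omega|_{C^1})$ depending only on $n$, $l$ and $|\omega|_{C^1}$. -/

import Mathlib

open Set Filter MeasureTheory
open scoped NNReal ENNReal Topology

noncomputable section

namespace HomEq

/-- `ℝⁿ` with its Euclidean norm. A function on the torus `𝕋ⁿ = ℝⁿ/ℤⁿ` is a `ℤⁿ`-periodic
function on `ℝⁿ`. -/
abbrev E (n : ℕ) := EuclideanSpace ℝ (Fin n)

/-- The point of `ℝⁿ` with the integer coordinates `k`. -/
def latt {n : ℕ} (k : Fin n → ℤ) : E n := WithLp.toLp 2 fun i => (k i : ℝ)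

/-- The open ball `B_{3/4}` of `ℝⁿ` centred at the origin. -/
def B34 (n : ℕ) : Set (E n) := Metric.ball 0 (3 / 4)

section Holder

variable {n : ℕ} {F : Type*} [NormedAddCommGroup F] [NormedSpace ℝ F]

/-- The partial derivative `∂^i f / ∂x_{a 0} ⋯ ∂x_{a (i-1)}` of order `i` at `x`. -/
def partialDeriv (i : ℕ) (a : Fin i → Fin n) (f : E n → F) (x : E n) : F :=
  iteratedFDeriv ℝ i f x fun j => EuclideanSpace.single (a j) (1 : ℝ)

/-- `|f|_{C^k}` on an open set `G`: the supremum over `G` of all partial derivatives of order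
at most `k`. -/
def cNorm (k : ℕ) (G : Set (E n)) (f : E n → F) : ℝ≥0∞ :=
  ⨆ i : Fin (k + 1), ⨆ a : Fin (i : ℕ) → Fin n, ⨆ x ∈ G, ‖partialDeriv (i : ℕ) a f x‖ₑ

/-- The `μ`-Hölder seminorm of the partial derivatives of order `k`. For a periodic function,
the Euclidean distance of `ℝⁿ` gives the same value as the distance of the torus. -/
def holderSeminorm (k : ℕ) (μ : ℝ) (f : E n → F) : ℝ≥0∞ :=
  ⨆ a : Fin k → Fin n, ⨆ x : E n, ⨆ y : E n, ⨆ _ : x ≠ y,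
    ENNReal.ofReal (‖partialDeriv k a f x - partialDeriv k a f y‖ / ‖x - y‖ ^ μ)

/-- The Hölder norm `|f|_{C^σ}` of a (periodic) function on `ℝⁿ`: the `C^σ` norm for an integer
`σ`; the `C^k` norm plus the `μ`-Hölder seminorm of the derivatives of order `k` for
`σ = k + μ`, `0 < μ < 1`. -/
def holderNorm (σ : ℝ) (f : E n → F) : ℝ≥0∞ :=
  cNorm ⌊σ⌋₊ univ f +
    if (⌊σ⌋₊ : ℝ) = σ then 0 else holderSeminorm ⌊σ⌋₊ (σ - (⌊σ⌋₊ : ℝ)) f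

/-- The Hölder class `C^σ`. -/
def IsHolder (σ : ℝ) (f : E n → F) : Prop :=
  ContDiff ℝ (⌊σ⌋₊ : ℕ) f ∧ holderNorm σ f < ⊤

end Holder

section Spaces

variable {n : ℕ}

/-- The domain `𝕋ⁿ × ℝ⁺ × B_{3/4}` (with `𝕋ⁿ` unfolded to `ℝⁿ`), points `(θ, t, p₀)`. -/
def dom (n : ℕ) : Set (E n × ℝ × E n) := univ ×ˢ (Ici (0 : ℝ) ×ˢ B34 n)

/-- `∂_{p₀} f (θ, t; p₀)`. -/
def dp (f : E n → ℝ → E n → ℝ) (θ : E n) (t : ℝ) (p : E n) : E n →L[ℝ] ℝ :=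
  fderiv ℝ (fun p' => f θ t p') p

/-- `∂_θ f (θ, t; p₀)`. -/
def dθ (f : E n → ℝ → E n → ℝ) (θ : E n) (t : ℝ) (p : E n) : E n →L[ℝ] ℝ :=
  fderiv ℝ (fun θ' => f θ' t p) θ

/-- Functions `f(θ, t; p₀)` on `𝕋ⁿ × ℝ⁺ × B_{3/4}` that are continuous, everywhere
differentiable in `p₀`, and of class `C^σ` in `θ` for all fixed `(t, p₀)`.
This is `B⁺_σ` without the continuity of `∂_{p₀} f`. -/
structure MemPreB (σ : ℝ) (f : E n → ℝ → E n → ℝ) : Prop where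
  periodic : ∀ θ : E n, ∀ t : ℝ, 0 ≤ t → ∀ p ∈ B34 n, ∀ k : Fin n → ℤ,
    f (θ + latt k) t p = f θ t p
  continuous : ContinuousOn (fun z : E n × ℝ × E n => f z.1 z.2.1 z.2.2) (dom n)
  differentiable : ∀ θ : E n, ∀ t : ℝ, 0 ≤ t → ∀ p ∈ B34 n,
    DifferentiableAt ℝ (fun p' => f θ t p') p
  holder : ∀ t : ℝ, 0 ≤ t → ∀ p ∈ B34 n, IsHolder σ fun θ => f θ t p

/-- The space `B⁺_σ`: `f` and `∂_{p₀} f` exist and are continuous, and `f^t_{p₀} ∈ C^σ(𝕋ⁿ)`. -/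
structure MemB (σ : ℝ) (f : E n → ℝ → E n → ℝ) : Prop extends MemPreB σ f where
  continuous_dp : ContinuousOn (fun z : E n × ℝ × E n => dp f z.1 z.2.1 z.2.2) (dom n)

/-- The weighted norm `|f|⁺_{σ,l}`. -/
def wNorm (σ l : ℝ) (f : E n → ℝ → E n → ℝ) : ℝ≥0∞ :=
  (⨆ t ∈ Ici (0 : ℝ), ⨆ p ∈ B34 n,
      holderNorm σ (fun θ => f θ t p) * ENNReal.ofReal (1 + t ^ l)) +
    ⨆ t ∈ Ici (0 : ℝ), ⨆ p ∈ B34 n,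
      (⨆ θ : E n, ‖dp f θ t p‖ₑ) * ENNReal.ofReal (1 + t ^ (l - 1))

/-- `κ` solves `ω(p₀) · ∂_θ κ + ∂_t κ = g` at every point of `𝕋ⁿ × ℝ⁺ × B_{3/4}`
(the derivative in `t` is one-sided at `t = 0`). -/
def IsSolution (ω : E n → E n) (g κ : E n → ℝ → E n → ℝ) : Prop :=
  ∀ θ : E n, ∀ t : ℝ, 0 ≤ t → ∀ p ∈ B34 n,
    DifferentiableAt ℝ (fun θ' => κ θ' t p) θ ∧
    ∃ d : ℝ, HasDerivWithinAt (fun s => κ θ s p) d (Ici 0) t ∧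
      dθ κ θ t p (ω p) + d = g θ t p

/-- For each `p₀`, the sup norm `|κ^t_{p₀}|_{C⁰}` tends to `0` as `t → +∞`. -/
def Decays (κ : E n → ℝ → E n → ℝ) : Prop :=
  ∀ p ∈ B34 n, Tendsto (fun t : ℝ => ⨆ θ : E n, ‖κ θ t p‖ₑ) atTop (𝓝 0)

/-- `-∫_t^{+∞} g(θ + ω(p₀)(τ - t), τ; p₀) dτ`. -/
def sol (ω : E n → E n) (g : E n → ℝ → E n → ℝ) (θ : E n) (t : ℝ) (p : E n) : ℝ :=
  -∫ τ in Ioi t, g (θ + (τ - t) • ω p) τ p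

end Spaces

end HomEq

end

open HomEq

namespace HomEq

/-! ### Weights -/

theorem one_add_rpow_le {t a : ℝ} (ht : 0 ≤ t) (ha : 1 ≤ a) :
    (1 + t) ^ a ≤ 2 ^ (a - 1) * (1 + t ^ a) := by
  have h := NNReal.rpow_add_le_mul_rpow_add_rpow 1 ⟨t, ht⟩ ha
  have h' := NNReal.coe_le_coe.2 h
  simp only [NNReal.coe_rpow, NNReal.coe_mul, NNReal.coe_add, NNReal.coe_one, NNReal.coe_ofNat,
    Real.one_rpow] at h'
  exact h'

theorem one_add_rpow_le_two_mul {t a : ℝ} (ht : 0 ≤ t) (ha : 0 ≤ a) :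
    1 + t ^ a ≤ 2 * (1 + t) ^ a := by
  have h1 : 1 ≤ (1 + t) ^ a := Real.one_le_rpow (by linarith) ha
  have h2 : t ^ a ≤ (1 + t) ^ a := Real.rpow_le_rpow ht (by linarith) ha
  linarith

theorem le_two_rpow_mul_of_mul_le {x N t a : ℝ} (ht : 0 ≤ t) (ha : 1 ≤ a) (hN : 0 ≤ N)
    (h : x * (1 + t ^ a) ≤ N) : x ≤ 2 ^ (a - 1) * N * (1 + t) ^ (-a) := by
  have hpos : 0 < 1 + t ^ a := by positivity
  have hpos' : 0 < (1 + t) ^ a := by positivity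
  have h1 := one_add_rpow_le ht ha
  rw [Real.rpow_neg (by positivity), ← div_eq_mul_inv, le_div_iff₀ hpos']
  rcases le_total x 0 with hx | hx
  · exact (mul_nonpos_of_nonpos_of_nonneg hx hpos'.le).trans (by positivity)
  · calc x * (1 + t) ^ a ≤ x * (2 ^ (a - 1) * (1 + t ^ a)) := by gcongr
      _ = 2 ^ (a - 1) * (x * (1 + t ^ a)) := by ring
      _ ≤ 2 ^ (a - 1) * N := by gcongr

theorem integrableOn_weight {t a : ℝ} (ht : 0 ≤ t) (ha : 1 < a) :
    IntegrableOn (fun s : ℝ => (1 + (t + s)) ^ (-a)) (Ioi 0) := by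
  have h := integrableOn_add_rpow_Ioi_of_lt (a := -a) (c := 0) (m := 1 + t) (by linarith)
    (by linarith)
  refine h.congr_fun (fun s _ => ?_) measurableSet_Ioi
  ring_nf

theorem integral_weight {t a : ℝ} (ht : 0 ≤ t) (ha : 1 < a) :
    ∫ s in Ioi (0 : ℝ), (1 + (t + s)) ^ (-a) = (1 + t) ^ (-(a - 1)) / (a - 1) := by
  have hd : ∀ x ∈ Ici (0 : ℝ), HasDerivAt (fun s : ℝ => (1 + (t + s)) ^ (-(a - 1)) / (-(a - 1)))
      ((1 + (t + x)) ^ (-a)) x := by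
    intro x hx
    have hx' : (0 : ℝ) ≤ x := hx
    have h1 : HasDerivAt (fun s : ℝ => 1 + (t + s)) 1 x :=
      ((hasDerivAt_id x).const_add t).const_add 1
    have h2 := (h1.rpow_const (p := -(a - 1)) (Or.inl (by linarith))).div_const (-(a - 1))
    convert! h2 using 1
    have : -(a - 1) ≠ 0 := by linarith
    rw [one_mul, show -(a - 1) - 1 = -a by ring, mul_div_cancel_left₀ _ this]
  have hlim : Tendsto (fun s : ℝ => (1 + (t + s)) ^ (-(a - 1)) / (-(a - 1))) atTop (𝓝 0) := by
    have h1 : Tendsto (fun s : ℝ => 1 + (t + s)) atTop atTop :=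
      tendsto_atTop_add_const_left _ _ (tendsto_atTop_add_const_left _ _ tendsto_id)
    simpa using ((tendsto_rpow_neg_atTop (by linarith : 0 < a - 1)).comp h1).div_const (-(a - 1))
  rw [integral_Ioi_of_hasDerivAt_of_tendsto' hd (integrableOn_weight ht ha) hlim]
  simp only [add_zero, zero_sub]
  rw [div_neg, neg_neg]

/-! ### Linear maps and partial derivatives -/

variable {n : ℕ} {F : Type*} [NormedAddCommGroup F] [NormedSpace ℝ F]

/-- The `j`-th vector of the standard basis of `ℝⁿ`. -/
noncomputable abbrev stdVec (j : Fin n) : E n := EuclideanSpace.single j (1 : ℝ)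

theorem clm_apply_eq_sum (L : E n →L[ℝ] F) (v : E n) : L v = ∑ j, v j • L (stdVec j) := by
  conv_lhs => rw [← (EuclideanSpace.basisFun (Fin n) ℝ).sum_repr v]
  simp

theorem clm_norm_le {L : E n →L[ℝ] F} {c : ℝ} (hc : 0 ≤ c) (h : ∀ j, ‖L (stdVec j)‖ ≤ c) :
    ‖L‖ ≤ n * c := by
  refine L.opNorm_le_bound (by positivity) fun v => ?_
  rw [clm_apply_eq_sum]
  calc ‖∑ j, v j • L (stdVec j)‖ ≤ ∑ j : Fin n, ‖v‖ * c := by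
        refine norm_sum_le_of_le _ fun j _ => ?_
        rw [norm_smul]
        exact mul_le_mul (PiLp.norm_apply_le v j) (h j) (norm_nonneg _) (norm_nonneg _)
    _ = n * c * ‖v‖ := by simp; ring

theorem clm_eq_sum (L : E n →L[ℝ] ℝ) :
    L = ∑ j, L (stdVec j) • (EuclideanSpace.proj j : E n →L[ℝ] ℝ) := by
  ext v
  rw [clm_apply_eq_sum]
  simp [mul_comm]

theorem partialDeriv_zero (a : Fin 0 → Fin n) (f : E n → F) (x : E n) :
    partialDeriv 0 a f x = f x := by
  simp [partialDeriv]

theorem partialDeriv_one (a : Fin 1 → Fin n) (f : E n → F) (x : E n) :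
    partialDeriv 1 a f x = fderiv ℝ f x (stdVec (a 0)) := by
  simp [partialDeriv]

theorem partialDeriv_succ {k i : ℕ} {f : E n → F} (hf : ContDiff ℝ (k + 1 : ℕ) f) (hi : i ≤ k)
    (a : Fin (i + 1) → Fin n) (x : E n) :
    partialDeriv (i + 1) a f x =
      partialDeriv i (Fin.init a) (fun y => fderiv ℝ f y (stdVec (a (Fin.last i)))) x := by
  have hf' : ContDiff ℝ (k : ℕ) (fderiv ℝ f) := hf.fderiv_right (by norm_cast)
  simp only [partialDeriv]
  rw [iteratedFDeriv_succ_apply_right, iteratedFDeriv_clm_apply_const_apply hf' (by exact_mod_cast hi)]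
  rfl

theorem partialDeriv_snoc {k i : ℕ} {f : E n → F} (hf : ContDiff ℝ (k + 1 : ℕ) f) (hi : i ≤ k)
    (a : Fin i → Fin n) (j : Fin n) (x : E n) :
    partialDeriv i a (fun y => fderiv ℝ f y (stdVec j)) x =
      partialDeriv (i + 1) (Fin.snoc a j : Fin (i + 1) → Fin n) f x := by
  rw [partialDeriv_succ hf hi]
  simp

theorem contDiff_succ_of_stdVec {k : ℕ} {f : E n → F} (hf : Differentiable ℝ f)
    (h : ∀ j, ContDiff ℝ k fun x => fderiv ℝ f x (stdVec j)) : ContDiff ℝ (k + 1 : ℕ) f := by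
  push_cast
  rw [contDiff_succ_iff_fderiv_apply]
  refine ⟨hf, by simp, fun y => ?_⟩
  have : (fun x => fderiv ℝ f x y) = fun x => ∑ j, y j • fderiv ℝ f x (stdVec j) := by
    ext x; exact clm_apply_eq_sum _ _
  rw [this]
  exact ContDiff.sum fun j _ => (h j).const_smul (y j)

/-! ### Differentiation of integrals depending on a parameter -/

section Parametric

variable {α : Type*} [MeasurableSpace α] {μ : Measure α}

theorem aestronglyMeasurable_fderiv_apply {h : α → E n → ℝ} {x : E n}
    (hm : ∀ θ, AEStronglyMeasurable (fun s => h s θ) μ)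
    (hd : ∀ᵐ s ∂μ, DifferentiableAt ℝ (h s) x) (v : E n) :
    AEStronglyMeasurable (fun s => fderiv ℝ (h s) x v) μ := by
  refine aestronglyMeasurable_of_tendsto_ae atTop
    (f := fun (m : ℕ) s => (m : ℝ) • (h s (x + (m : ℝ)⁻¹ • v) - h s x)) ?_ ?_
  · intro m
    exact ((hm _).sub (hm _)).const_smul (m : ℝ)
  · filter_upwards [hd] with s hs
    exact (hs.hasFDerivAt.lim_real v).comp tendsto_natCast_atTop_atTop

theorem aestronglyMeasurable_fderiv {h : α → E n → ℝ} {x : E n}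
    (hm : ∀ θ, AEStronglyMeasurable (fun s => h s θ) μ)
    (hd : ∀ᵐ s ∂μ, DifferentiableAt ℝ (h s) x) :
    AEStronglyMeasurable (fun s => fderiv ℝ (h s) x) μ := by
  have : (fun s => fderiv ℝ (h s) x) = fun s => ∑ j, fderiv ℝ (h s) x (stdVec j) •
      (EuclideanSpace.proj j : E n →L[ℝ] ℝ) := by
    ext1 s; exact clm_eq_sum _
  rw [this]
  refine Finset.aestronglyMeasurable_fun_sum _ fun j _ => ?_
  exact (aestronglyMeasurable_fderiv_apply hm hd _).smul_const _

theorem hasFDerivAt_integral_of_stdVec {h : α → E n → ℝ} {b : α → ℝ}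
    (hm : ∀ θ, AEStronglyMeasurable (fun s => h s θ) μ)
    (hd : ∀ᵐ s ∂μ, Differentiable ℝ (h s)) (hb : Integrable b μ)
    (h0 : ∀ᵐ s ∂μ, ∀ x, ‖h s x‖ ≤ b s)
    (h1 : ∀ᵐ s ∂μ, ∀ x j, ‖fderiv ℝ (h s) x (stdVec j)‖ ≤ b s) (x : E n) :
    HasFDerivAt (fun θ => ∫ s, h s θ ∂μ) (∫ s, fderiv ℝ (h s) x ∂μ) x ∧
      Integrable (fun s => fderiv ℝ (h s) x) μ := by
  have hd' : ∀ᵐ s ∂μ, DifferentiableAt ℝ (h s) x := hd.mono fun s hs => hs x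
  have hbd : ∀ᵐ s ∂μ, ∀ y, ‖fderiv ℝ (h s) y‖ ≤ n * b s := by
    filter_upwards [h0, h1] with s h0 h1 y
    exact clm_norm_le ((norm_nonneg _).trans (h0 y)) (h1 y)
  refine ⟨hasFDerivAt_integral_of_dominated_of_fderiv_le (s := univ)
    (bound := fun s => n * b s) univ_mem
    (Eventually.of_forall hm) (hb.mono' (hm x) (h0.mono fun s hs => hs x))
    (aestronglyMeasurable_fderiv hm hd') (hbd.mono fun s hs y _ => hs y) (hb.const_mul _)
    (hd.mono fun s hs y _ => (hs y).hasFDerivAt),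
    (hb.const_mul (n : ℝ)).mono' (aestronglyMeasurable_fderiv hm hd') (hbd.mono fun s hs => hs x)⟩

theorem contDiff_integral (k : ℕ) (h : α → E n → ℝ) (b : α → ℝ)
    (hm : ∀ θ, AEStronglyMeasurable (fun s => h s θ) μ)
    (hd : ∀ᵐ s ∂μ, ContDiff ℝ k (h s)) (hb : Integrable b μ)
    (hbd : ∀ᵐ s ∂μ, ∀ i ≤ k, ∀ (a : Fin i → Fin n) x, ‖partialDeriv i a (h s) x‖ ≤ b s) :
    ContDiff ℝ k (fun θ => ∫ s, h s θ ∂μ) ∧ ∀ i ≤ k, ∀ (a : Fin i → Fin n) x,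
      AEStronglyMeasurable (fun s => partialDeriv i a (h s) x) μ ∧
      partialDeriv i a (fun θ => ∫ s, h s θ ∂μ) x = ∫ s, partialDeriv i a (h s) x ∂μ := by
  induction k generalizing h with
  | zero =>
    have h0 : ∀ᵐ s ∂μ, ∀ x, ‖h s x‖ ≤ b s := by
      filter_upwards [hbd] with s hs x
      simpa [partialDeriv_zero] using hs 0 le_rfl Fin.elim0 x
    constructor
    · rw [Nat.cast_zero, contDiff_zero]
      refine continuous_of_dominated hm (fun x => h0.mono fun s hs => hs x) hb ?_
      filter_upwards [hd] with s hs
      exact hs.continuous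
    · intro i hi a x
      obtain rfl : i = 0 := by omega
      simp only [partialDeriv_zero]
      exact ⟨hm x, trivial⟩
  | succ k ih =>
    have h0 : ∀ᵐ s ∂μ, ∀ x, ‖h s x‖ ≤ b s := by
      filter_upwards [hbd] with s hs x
      simpa [partialDeriv_zero] using hs 0 (by omega) Fin.elim0 x
    have h1 : ∀ᵐ s ∂μ, ∀ x j, ‖fderiv ℝ (h s) x (stdVec j)‖ ≤ b s := by
      filter_upwards [hbd] with s hs x j
      simpa [partialDeriv_one] using hs 1 (by omega) (fun _ => j) x
    have hdiff : ∀ᵐ s ∂μ, Differentiable ℝ (h s) := by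
      filter_upwards [hd] with s hs
      exact hs.differentiable (by simp)
    have key := hasFDerivAt_integral_of_stdVec hm hdiff hb h0 h1
    have hf : ∀ x j, fderiv ℝ (fun θ => ∫ s, h s θ ∂μ) x (stdVec j) =
        ∫ s, fderiv ℝ (h s) x (stdVec j) ∂μ := by
      intro x j
      rw [(key x).1.fderiv, ContinuousLinearMap.integral_apply (key x).2]
    have IH := fun j => ih (fun s x => fderiv ℝ (h s) x (stdVec j))
      (fun θ => aestronglyMeasurable_fderiv_apply hm (hdiff.mono fun s hs => hs θ) _)
      (hd.mono fun s hs => (hs.fderiv_right (m := (k : ℕ)) (by norm_cast)).clm_apply contDiff_const)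
      (by
        filter_upwards [hd, hbd] with s hs hbs i hi a x
        rw [partialDeriv_snoc hs hi]
        exact hbs _ (by omega) _ _)
    have hC : ContDiff ℝ (k + 1 : ℕ) (fun θ => ∫ s, h s θ ∂μ) := by
      refine contDiff_succ_of_stdVec (fun x => (key x).1.differentiableAt) fun j => ?_
      simp only [hf]
      exact (IH j).1
    refine ⟨hC, ?_⟩
    intro i hi a x
    cases i with
    | zero =>
      simp only [partialDeriv_zero]
      exact ⟨hm x, trivial⟩
    | succ i =>
      have hi' : i ≤ k := by omega
      obtain ⟨hm', he⟩ := (IH (a (Fin.last i))).2 i hi' (Fin.init a) x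
      have hcongr : (fun s => partialDeriv i (Fin.init a)
          (fun y => fderiv ℝ (h s) y (stdVec (a (Fin.last i)))) x) =ᵐ[μ]
          fun s => partialDeriv (i + 1) a (h s) x := by
        filter_upwards [hd] with s hs
        rw [partialDeriv_succ hs hi']
      refine ⟨hm'.congr hcongr, ?_⟩
      rw [partialDeriv_succ hC hi', ← integral_congr_ae hcongr, ← he]
      simp only [hf]

end Parametric

end HomEq

namespace HomEq

variable {n : ℕ} {F : Type*} [NormedAddCommGroup F] [NormedSpace ℝ F]

/-! ### Pointwise bounds and the Hölder norm -/

theorem enorm_partialDeriv_le_cNorm {k i : ℕ} {G : Set (E n)} (f : E n → F) (hi : i ≤ k)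
    (a : Fin i → Fin n) {x : E n} (hx : x ∈ G) : ‖partialDeriv i a f x‖ₑ ≤ cNorm k G f := by
  unfold cNorm
  exact le_iSup_of_le (⟨i, by omega⟩ : Fin (k + 1)) <| le_iSup_of_le a <|
    le_iSup₂_of_le x hx le_rfl

theorem cNorm_le_holderNorm (σ : ℝ) (f : E n → F) : cNorm ⌊σ⌋₊ univ f ≤ holderNorm σ f :=
  le_self_add

theorem holderSeminorm_le_holderNorm {σ : ℝ} (hσ : (⌊σ⌋₊ : ℝ) ≠ σ) (f : E n → F) :
    holderSeminorm ⌊σ⌋₊ (σ - ⌊σ⌋₊) f ≤ holderNorm σ f := by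
  unfold holderNorm
  rw [if_neg hσ]
  exact le_add_self

/-- The partial derivatives of order at most `⌊σ⌋` and, for a non-integer `σ`, the Hölder
quotients of those of order `⌊σ⌋` are bounded by `c`. -/
structure HolderBound (σ c : ℝ) (f : E n → F) : Prop where
  partial_le : ∀ i ≤ ⌊σ⌋₊, ∀ (a : Fin i → Fin n) x, ‖partialDeriv i a f x‖ ≤ c
  holder_le : (⌊σ⌋₊ : ℝ) ≠ σ → ∀ (a : Fin ⌊σ⌋₊ → Fin n) x y,
    ‖partialDeriv ⌊σ⌋₊ a f x - partialDeriv ⌊σ⌋₊ a f y‖ ≤ c * ‖x - y‖ ^ (σ - ⌊σ⌋₊)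

theorem HolderBound.norm_le {σ c : ℝ} {f : E n → F} (h : HolderBound σ c f) (x : E n) :
    ‖f x‖ ≤ c := by
  simpa [partialDeriv_zero] using h.partial_le 0 (Nat.zero_le _) Fin.elim0 x

theorem HolderBound.nonneg {σ c : ℝ} {f : E n → F} (h : HolderBound σ c f) : 0 ≤ c :=
  (norm_nonneg _).trans (h.norm_le 0)

theorem HolderBound.fderiv_stdVec_le {σ c : ℝ} {f : E n → F} (hσ : 1 ≤ σ)
    (h : HolderBound σ c f) (x : E n) (j : Fin n) : ‖fderiv ℝ f x (stdVec j)‖ ≤ c := by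
  simpa [partialDeriv_one] using h.partial_le 1 (Nat.le_floor (by simpa using hσ)) (fun _ => j) x

theorem HolderBound.fderiv_le {σ c : ℝ} {f : E n → F} (hσ : 1 ≤ σ)
    (h : HolderBound σ c f) (x : E n) : ‖fderiv ℝ f x‖ ≤ n * c :=
  clm_norm_le h.nonneg (h.fderiv_stdVec_le hσ x)

theorem HolderBound.of_mul_le {σ N t a : ℝ} {f : E n → F} (ht : 0 ≤ t) (ha : 1 ≤ a) (hN : 0 ≤ N)
    (h : holderNorm σ f * ENNReal.ofReal (1 + t ^ a) ≤ ENNReal.ofReal N) :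
    HolderBound σ (2 ^ (a - 1) * N * (1 + t) ^ (-a)) f := by
  have hw : (0 : ℝ) ≤ 1 + t ^ a := by positivity
  constructor
  · intro i hi b x
    refine le_two_rpow_mul_of_mul_le ht ha hN ?_
    have h1 : ‖partialDeriv i b f x‖ₑ * ENNReal.ofReal (1 + t ^ a) ≤ ENNReal.ofReal N := by
      refine le_trans ?_ h
      gcongr
      exact (enorm_partialDeriv_le_cNorm f hi b (mem_univ x)).trans (cNorm_le_holderNorm σ f)
    rw [← ofReal_norm, ← ENNReal.ofReal_mul (norm_nonneg _)] at h1
    exact (ENNReal.ofReal_le_ofReal_iff hN).1 h1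
  · intro hσ b x y
    rcases eq_or_ne x y with rfl | hxy
    · rw [sub_self, norm_zero]; positivity
    have hpos : 0 < ‖x - y‖ ^ (σ - ⌊σ⌋₊) :=
      Real.rpow_pos_of_pos (norm_pos_iff.2 (sub_ne_zero.2 hxy)) _
    rw [← div_le_iff₀ hpos]
    refine le_two_rpow_mul_of_mul_le ht ha hN ?_
    have h1 : ENNReal.ofReal (‖partialDeriv ⌊σ⌋₊ b f x - partialDeriv ⌊σ⌋₊ b f y‖ /
        ‖x - y‖ ^ (σ - ⌊σ⌋₊)) * ENNReal.ofReal (1 + t ^ a) ≤ ENNReal.ofReal N := by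
      refine le_trans ?_ h
      gcongr
      refine le_trans ?_ (holderSeminorm_le_holderNorm hσ f)
      unfold holderSeminorm
      exact le_iSup_of_le b <| le_iSup_of_le x <| le_iSup₂_of_le y hxy le_rfl
    rw [← ENNReal.ofReal_mul (by positivity)] at h1
    exact (ENNReal.ofReal_le_ofReal_iff hN).1 h1

theorem HolderBound.holderNorm_le {σ c : ℝ} {f : E n → F} (h : HolderBound σ c f) :
    holderNorm σ f ≤ ENNReal.ofReal (2 * c) := by
  have hc := h.nonneg
  have h1 : cNorm ⌊σ⌋₊ univ f ≤ ENNReal.ofReal c := by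
    unfold cNorm
    refine iSup_le fun i => iSup_le fun a => iSup₂_le fun x _ => ?_
    rw [← ofReal_norm]
    exact ENNReal.ofReal_le_ofReal (h.partial_le i (by omega) a x)
  rw [two_mul, ENNReal.ofReal_add hc hc]
  unfold holderNorm
  refine add_le_add h1 ?_
  split_ifs with hσ
  · exact zero_le
  · unfold holderSeminorm
    refine iSup_le fun a => iSup_le fun x => iSup_le fun y => iSup_le fun hxy => ?_
    refine ENNReal.ofReal_le_ofReal ?_
    rw [div_le_iff₀ (Real.rpow_pos_of_pos (norm_pos_iff.2 (sub_ne_zero.2 hxy)) _)]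
    exact h.holder_le hσ a x y

/-- Pointwise form of the finiteness of the weighted norm `|f|⁺_{σ,l}`. -/
structure WeightedBound (σ l N : ℝ) (f : E n → ℝ → E n → ℝ) : Prop where
  holder : ∀ t, 0 ≤ t → ∀ p ∈ B34 n, HolderBound σ (N * (1 + t) ^ (-l)) fun θ => f θ t p
  dp_le : ∀ θ t, 0 ≤ t → ∀ p ∈ B34 n, ‖dp f θ t p‖ ≤ N * (1 + t) ^ (-(l - 1))

theorem weightedBound_of_wNorm_lt_top {σ l : ℝ} {f : E n → ℝ → E n → ℝ} (hl : 2 ≤ l)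
    (h : wNorm σ l f < ⊤) : WeightedBound σ l (2 ^ (l - 1) * (wNorm σ l f).toReal) f := by
  have hN : wNorm σ l f = ENNReal.ofReal (wNorm σ l f).toReal := (ENNReal.ofReal_toReal h.ne).symm
  constructor
  · intro t ht p hp
    refine HolderBound.of_mul_le ht (by linarith) ENNReal.toReal_nonneg ?_
    rw [← hN]
    unfold wNorm
    exact le_add_right (le_iSup₂_of_le t ht <| le_iSup₂_of_le p hp le_rfl)
  · intro θ t ht p hp
    have h1 : ‖dp f θ t p‖ₑ * ENNReal.ofReal (1 + t ^ (l - 1)) ≤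
        ENNReal.ofReal (wNorm σ l f).toReal := by
      rw [← hN]
      unfold wNorm
      refine le_add_left (le_iSup₂_of_le t ht <| le_iSup₂_of_le p hp ?_)
      gcongr
      exact le_iSup (fun θ => ‖dp f θ t p‖ₑ) θ
    rw [← ofReal_norm, ← ENNReal.ofReal_mul (norm_nonneg _),
      ENNReal.ofReal_le_ofReal_iff ENNReal.toReal_nonneg] at h1
    refine (le_two_rpow_mul_of_mul_le ht (by linarith) ENNReal.toReal_nonneg h1).trans ?_
    have : (0 : ℝ) ≤ (wNorm σ l f).toReal := ENNReal.toReal_nonneg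
    gcongr
    · norm_num
    · linarith

theorem WeightedBound.nonneg {σ l N : ℝ} {f : E n → ℝ → E n → ℝ} (h : WeightedBound σ l N f) :
    0 ≤ N := by
  have := (h.holder 0 le_rfl 0 (by simp [B34])).nonneg
  simpa using this

theorem ofReal_mul_weight_le {x t a : ℝ} (ht : 0 ≤ t) (ha : 0 ≤ a) (hx : 0 ≤ x) :
    ENNReal.ofReal (x * (1 + t) ^ (-a)) * ENNReal.ofReal (1 + t ^ a) ≤ ENNReal.ofReal (2 * x) := by
  rw [← ENNReal.ofReal_mul (by positivity)]
  refine ENNReal.ofReal_le_ofReal ?_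
  have h1 := one_add_rpow_le_two_mul ht ha
  have hpos : 0 < (1 + t) ^ a := by positivity
  rw [Real.rpow_neg (by positivity)]
  calc x * ((1 + t) ^ a)⁻¹ * (1 + t ^ a) ≤ x * ((1 + t) ^ a)⁻¹ * (2 * (1 + t) ^ a) := by gcongr
    _ = 2 * x := by field_simp

theorem wNorm_le_of_bounds {σ l N₁ N₂ : ℝ} {f : E n → ℝ → E n → ℝ} (hl : 1 ≤ l) (h₁ : 0 ≤ N₁)
    (h₂ : 0 ≤ N₂)
    (hθ : ∀ t, 0 ≤ t → ∀ p ∈ B34 n, HolderBound σ (N₁ * (1 + t) ^ (-l)) fun θ => f θ t p)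
    (hp : ∀ θ t, 0 ≤ t → ∀ p ∈ B34 n, ‖dp f θ t p‖ ≤ N₂ * (1 + t) ^ (-(l - 1))) :
    wNorm σ l f ≤ ENNReal.ofReal (4 * N₁ + 2 * N₂) := by
  rw [ENNReal.ofReal_add (by positivity) (by positivity)]
  unfold wNorm
  refine add_le_add ?_ ?_
  · refine iSup₂_le fun t ht => iSup₂_le fun p hp => ?_
    calc _ ≤ ENNReal.ofReal (2 * N₁ * (1 + t) ^ (-l)) * ENNReal.ofReal (1 + t ^ l) := by
          gcongr
          rw [mul_assoc]
          exact (hθ t ht p hp).holderNorm_le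
      _ ≤ ENNReal.ofReal (2 * (2 * N₁)) := ofReal_mul_weight_le ht (by linarith) (by positivity)
      _ = _ := by ring_nf
  · refine iSup₂_le fun t ht => iSup₂_le fun p hpB => ?_
    calc _ ≤ ENNReal.ofReal (N₂ * (1 + t) ^ (-(l - 1))) * ENNReal.ofReal (1 + t ^ (l - 1)) := by
          gcongr
          refine iSup_le fun θ => ?_
          rw [← ofReal_norm]
          exact ENNReal.ofReal_le_ofReal (hp θ t ht p hpB)
      _ ≤ _ := ofReal_mul_weight_le ht (by linarith) h₂

theorem fderiv_norm_le_cNorm {G : Set (E n)} {ω : E n → F} (h : cNorm 1 G ω < ⊤) {p : E n}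
    (hp : p ∈ G) : ‖fderiv ℝ ω p‖ ≤ n * (cNorm 1 G ω).toReal := by
  refine clm_norm_le ENNReal.toReal_nonneg fun j => ?_
  have := enorm_partialDeriv_le_cNorm (k := 1) ω le_rfl (fun _ => j) hp
  rw [partialDeriv_one, ← ofReal_norm] at this
  exact (ENNReal.ofReal_le_iff_le_toReal h.ne).1 this

end HomEq

namespace HomEq

variable {n : ℕ}

/-! ### Transport along the linear flow -/

section Flow

variable {X : Type*} [TopologicalSpace X] {ω : E n → E n}

theorem isOpen_B34 : IsOpen (B34 n) := Metric.isOpen_ball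

theorem mem_dom {z : E n × ℝ × E n} : z ∈ dom n ↔ 0 ≤ z.2.1 ∧ z.2.2 ∈ B34 n := by
  simp [dom]

theorem continuousOn_flow {G : E n × ℝ × E n → X} (hG : ContinuousOn G (dom n))
    (hω : ContinuousOn ω (B34 n)) {s : ℝ} (hs : 0 ≤ s) :
    ContinuousOn (fun z : E n × ℝ × E n => G (z.1 + s • ω z.2.2, z.2.1 + s, z.2.2)) (dom n) := by
  have hω' : ContinuousOn (fun z : E n × ℝ × E n => ω z.2.2) (dom n) :=
    hω.comp (by fun_prop) fun z hz => (mem_dom.1 hz).2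
  refine hG.comp (f := fun z : E n × ℝ × E n => (z.1 + s • ω z.2.2, z.2.1 + s, z.2.2)) ?_ ?_
  · exact (continuousOn_fst.add (hω'.const_smul s)).prodMk (by fun_prop)
  · intro z hz
    rw [mem_dom] at hz ⊢
    exact ⟨add_nonneg hz.1 hs, hz.2⟩

theorem continuousOn_flow_time {G : E n × ℝ × E n → X} (hG : ContinuousOn G (dom n))
    {t : ℝ} (ht : 0 ≤ t) {p : E n} (hp : p ∈ B34 n) (θ v : E n) :
    ContinuousOn (fun s : ℝ => G (θ + s • v, t + s, p)) (Ici 0) := by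
  refine hG.comp (f := fun s : ℝ => (θ + s • v, t + s, p)) (by fun_prop) ?_
  intro s hs
  exact mem_dom.2 ⟨add_nonneg ht hs, hp⟩

theorem aestronglyMeasurable_flow {X : Type*} [NormedAddCommGroup X] {G : E n × ℝ × E n → X}
    (hG : ContinuousOn G (dom n)) {t : ℝ} (ht : 0 ≤ t) {p : E n} (hp : p ∈ B34 n) (θ v : E n) :
    AEStronglyMeasurable (fun s : ℝ => G (θ + s • v, t + s, p)) (volume.restrict (Ioi 0)) :=
  ((continuousOn_flow_time hG ht hp θ v).mono Ioi_subset_Ici_self).aestronglyMeasurable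
    measurableSet_Ioi

end Flow

variable {σ l N : ℝ} {ω : E n → E n} {g : E n → ℝ → E n → ℝ}

theorem preimage_add_left_Ioi (t : ℝ) : (fun s : ℝ => t + s) ⁻¹' Ioi t = Ioi 0 := by
  ext s; simp

theorem sol_eq (ω : E n → E n) (g : E n → ℝ → E n → ℝ) (θ : E n) (t : ℝ) (p : E n) :
    sol ω g θ t p = -∫ s in Ioi (0 : ℝ), g (θ + s • ω p) (t + s) p := by
  unfold sol
  rw [← (measurePreserving_add_left volume t).setIntegral_preimage_emb
    (measurableEmbedding_addLeft t), preimage_add_left_Ioi]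
  simp

theorem integrableOn_shift_iff (θ v : E n) (t : ℝ) (p : E n) :
    IntegrableOn (fun τ => g (θ + (τ - t) • v) τ p) (Ioi t) ↔
      IntegrableOn (fun s => g (θ + s • v) (t + s) p) (Ioi 0) := by
  rw [← (measurePreserving_add_left volume t).integrableOn_comp_preimage
    (measurableEmbedding_addLeft t), preimage_add_left_Ioi]
  simp [Function.comp_def]

theorem weight_le_weight_zero {t s a : ℝ} (ht : 0 ≤ t) (hs : 0 ≤ s) (ha : 0 ≤ a) :
    (1 + (t + s)) ^ (-a) ≤ (1 + (0 + s)) ^ (-a) :=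
  Real.rpow_le_rpow_of_nonpos (by linarith) (by linarith) (by linarith)

theorem ae_Ioi {P : ℝ → Prop} (h : ∀ s, 0 < s → P s) : ∀ᵐ s ∂volume.restrict (Ioi (0 : ℝ)), P s :=
  (ae_restrict_iff' measurableSet_Ioi).2 (Eventually.of_forall h)

theorem integrableOn_flow (hl : 1 < l) (hg : MemB σ g) (hb : WeightedBound σ (l + 1) N g)
    (θ v : E n) {t : ℝ} (ht : 0 ≤ t) {p : E n} (hp : p ∈ B34 n) :
    IntegrableOn (fun s => g (θ + s • v) (t + s) p) (Ioi 0) := by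
  refine ((integrableOn_weight ht (by linarith : 1 < l + 1)).const_mul N).mono'
    (aestronglyMeasurable_flow hg.continuous ht hp θ v) (ae_Ioi fun s hs => ?_)
  exact (hb.holder (t + s) (by linarith) p hp).norm_le _

theorem continuousOn_sol (hl : 1 < l) (hω : ContinuousOn ω (B34 n)) (hg : MemB σ g)
    (hb : WeightedBound σ (l + 1) N g) :
    ContinuousOn (fun z : E n × ℝ × E n => sol ω g z.1 z.2.1 z.2.2) (dom n) := by
  simp only [sol_eq]
  refine ContinuousOn.neg (continuousOn_of_dominated
    (bound := fun s => N * (1 + (0 + s)) ^ (-(l + 1))) ?_ ?_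
    ((integrableOn_weight le_rfl (by linarith : 1 < l + 1)).const_mul N) ?_)
  · intro z hz
    rw [mem_dom] at hz
    exact aestronglyMeasurable_flow hg.continuous hz.1 hz.2 z.1 (ω z.2.2)
  · intro z hz
    rw [mem_dom] at hz
    refine ae_Ioi fun s hs => ?_
    refine ((hb.holder (z.2.1 + s) (by linarith) z.2.2 hz.2).norm_le _).trans ?_
    have := hb.nonneg
    exact mul_le_mul_of_nonneg_left (weight_le_weight_zero hz.1 hs.le (by linarith)) this
  · exact ae_Ioi fun s hs => continuousOn_flow hg.continuous hω hs.le

theorem partialDeriv_comp_add_right {F : Type*} [NormedAddCommGroup F] [NormedSpace ℝ F]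
    (i : ℕ) (a : Fin i → Fin n) (f : E n → F) (c x : E n) :
    partialDeriv i a (fun θ => f (θ + c)) x = partialDeriv i a f (x + c) := by
  simp only [partialDeriv, iteratedFDeriv_comp_add_right]

theorem partialDeriv_neg {F : Type*} [NormedAddCommGroup F] [NormedSpace ℝ F]
    (i : ℕ) (a : Fin i → Fin n) (f : E n → F) (x : E n) :
    partialDeriv i a (fun θ => -f θ) x = -partialDeriv i a f x := by
  have := iteratedFDeriv_neg_apply (𝕜 := ℝ) (i := i) (f := f) (x := x)
  simp only [partialDeriv]
  rw [show (fun θ => -f θ) = -f from rfl, this]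
  rfl

theorem contDiff_sol (hl : 1 < l) (hg : MemB σ g) (hb : WeightedBound σ (l + 1) N g)
    {t : ℝ} (ht : 0 ≤ t) {p : E n} (hp : p ∈ B34 n) :
    ContDiff ℝ (⌊σ⌋₊ : ℕ) (fun θ => sol ω g θ t p) ∧
      HolderBound σ (N / l * (1 + t) ^ (-l)) fun θ => sol ω g θ t p := by
  have hl' : 1 < l + 1 := by linarith
  have hint := (integrableOn_weight ht hl').const_mul N
  obtain ⟨hC, hP⟩ := contDiff_integral (μ := volume.restrict (Ioi (0 : ℝ))) ⌊σ⌋₊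
    (fun s θ => g (θ + s • ω p) (t + s) p) (fun s => N * (1 + (t + s)) ^ (-(l + 1)))
    (fun θ => aestronglyMeasurable_flow hg.continuous ht hp θ (ω p))
    (ae_Ioi fun s hs => (hg.holder (t + s) (by linarith) p hp).1.comp
      (contDiff_id.add contDiff_const))
    hint
    (ae_Ioi fun s hs i hi a x => by
      rw [partialDeriv_comp_add_right i a (fun θ => g θ (t + s) p)]
      exact (hb.holder (t + s) (by linarith) p hp).partial_le i hi a _)
  have hI : ∫ s in Ioi (0 : ℝ), N * (1 + (t + s)) ^ (-(l + 1)) = N / l * (1 + t) ^ (-l) := by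
    rw [integral_const_mul, integral_weight ht hl']
    ring_nf
  simp only [sol_eq]
  refine ⟨hC.neg, ?_, ?_⟩
  · intro i hi a x
    rw [partialDeriv_neg, norm_neg, (hP i hi a x).2, ← hI]
    refine norm_integral_le_of_norm_le hint (ae_Ioi fun s hs => ?_)
    rw [partialDeriv_comp_add_right i a (fun θ => g θ (t + s) p)]
    exact (hb.holder (t + s) (by linarith) p hp).partial_le i hi a _
  · intro hσ a x y
    have hint' : ∀ x, Integrable (fun s => partialDeriv ⌊σ⌋₊ a
        (fun θ => g (θ + s • ω p) (t + s) p) x) (volume.restrict (Ioi 0)) := fun x =>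
      hint.mono' (hP _ le_rfl a x).1 (ae_Ioi fun s hs => by
        rw [partialDeriv_comp_add_right _ a (fun θ => g θ (t + s) p)]
        exact (hb.holder (t + s) (by linarith) p hp).partial_le _ le_rfl a _)
    rw [partialDeriv_neg, partialDeriv_neg, neg_sub_neg, norm_sub_rev, (hP _ le_rfl a x).2,
      (hP _ le_rfl a y).2, ← integral_sub (hint' x) (hint' y), ← hI, ← integral_mul_const]
    refine norm_integral_le_of_norm_le (hint.mul_const _) (ae_Ioi fun s hs => ?_)
    rw [partialDeriv_comp_add_right _ a (fun θ => g θ (t + s) p),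
      partialDeriv_comp_add_right _ a (fun θ => g θ (t + s) p)]
    simpa using (hb.holder (t + s) (by linarith) p hp).holder_le hσ a (x + s • ω p) (y + s • ω p)

theorem periodic_sol (hg : MemB σ g) (θ : E n) {t : ℝ} (ht : 0 ≤ t) {p : E n} (hp : p ∈ B34 n)
    (k : Fin n → ℤ) : sol ω g (θ + latt k) t p = sol ω g θ t p := by
  simp only [sol_eq]
  congr 1
  refine setIntegral_congr_fun measurableSet_Ioi fun s hs => ?_
  have hs' : (0 : ℝ) < s := hs
  rw [add_right_comm, hg.periodic _ _ (by linarith) p hp]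

theorem isHolder_sol (hl : 1 < l) (hg : MemB σ g) (hb : WeightedBound σ (l + 1) N g)
    {t : ℝ} (ht : 0 ≤ t) {p : E n} (hp : p ∈ B34 n) : IsHolder σ fun θ => sol ω g θ t p :=
  ⟨(contDiff_sol hl hg hb ht hp).1,
    (contDiff_sol hl hg hb ht hp).2.holderNorm_le.trans_lt ENNReal.ofReal_lt_top⟩

theorem decays_sol (hl : 1 < l) (hg : MemB σ g) (hb : WeightedBound σ (l + 1) N g) :
    Decays (sol ω g) := by
  intro p hp
  have hlim : Tendsto (fun t : ℝ => ENNReal.ofReal (N / l * (1 + t) ^ (-l))) atTop (𝓝 0) := by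
    have h1 : Tendsto (fun t : ℝ => 1 + t) atTop atTop :=
      tendsto_atTop_add_const_left _ _ tendsto_id
    have h2 := ((tendsto_rpow_neg_atTop (by linarith : 0 < l)).comp h1).const_mul (N / l)
    simpa using ENNReal.tendsto_ofReal h2
  refine tendsto_of_tendsto_of_tendsto_of_le_of_le' tendsto_const_nhds hlim
    (Eventually.of_forall fun _ => zero_le) ?_
  filter_upwards [eventually_ge_atTop 0] with t ht
  refine iSup_le fun θ => ?_
  rw [← ofReal_norm]
  exact ENNReal.ofReal_le_ofReal ((contDiff_sol hl hg hb ht hp).2.norm_le θ)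

end HomEq

namespace HomEq

variable {n : ℕ}

/-! ### Differentiability in the parameter -/

/-- A function of two variables with one partial derivative at the point, and the other one near
the point and continuous there, is differentiable. -/
theorem hasFDerivAt_uncurry_of_continuousAt_snd {E₁ E₂ F : Type*} [NormedAddCommGroup E₁]
    [NormedSpace ℝ E₁] [NormedAddCommGroup E₂] [NormedSpace ℝ E₂] [NormedAddCommGroup F]
    [NormedSpace ℝ F] {f : E₁ → E₂ → F} {x₀ : E₁} {p₀ : E₂} {A : E₁ →L[ℝ] F}
    {D : E₁ → E₂ → E₂ →L[ℝ] F} (hA : HasFDerivAt (fun x => f x p₀) A x₀)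
    (hD : ∀ᶠ z in 𝓝 (x₀, p₀), HasFDerivAt (fun p => f z.1 p) (D z.1 z.2) z.2)
    (hc : ContinuousAt (fun z : E₁ × E₂ => D z.1 z.2) (x₀, p₀)) :
    HasFDerivAt (fun z : E₁ × E₂ => f z.1 z.2) (A.coprod (D x₀ p₀)) (x₀, p₀) := by
  have h1 : (fun z : E₁ × E₂ => f z.1 p₀ - f x₀ p₀ - A (z.1 - x₀)) =o[𝓝 (x₀, p₀)]
      fun z => z - (x₀, p₀) := by
    have h := hA.isLittleO.comp_tendsto (continuous_fst.tendsto (x₀, p₀))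
    refine h.trans_isBigO (Asymptotics.isBigO_of_le _ fun z => ?_)
    exact norm_fst_le (z - (x₀, p₀))
  have h2 : (fun z : E₁ × E₂ => f z.1 z.2 - f z.1 p₀ - D x₀ p₀ (z.2 - p₀)) =o[𝓝 (x₀, p₀)]
      fun z => z - (x₀, p₀) := by
    rw [Asymptotics.isLittleO_iff]
    intro ε hε
    have hc' : ∀ᶠ z : E₁ × E₂ in 𝓝 (x₀, p₀), ‖D z.1 z.2 - D x₀ p₀‖ ≤ ε := by
      have := Metric.continuousAt_iff'.1 hc ε hε
      filter_upwards [this] with z hz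
      rw [dist_eq_norm] at hz
      exact hz.le
    obtain ⟨δ, hδ, hball⟩ := Metric.eventually_nhds_iff_ball.1 (hD.and hc')
    filter_upwards [Metric.ball_mem_nhds (x₀, p₀) hδ] with z hz
    rw [← ball_prod_same] at hz hball
    have hz1 : z.1 ∈ Metric.ball x₀ δ := hz.1
    have hz2 : z.2 ∈ Metric.ball p₀ δ := hz.2
    have := (convex_ball p₀ δ).norm_image_sub_le_of_norm_hasFDerivWithin_le' (f := fun p => f z.1 p)
      (f' := fun p => D z.1 p) (φ := D x₀ p₀) (C := ε)
      (fun p hp => (hball (z.1, p) ⟨hz1, hp⟩).1.hasFDerivWithinAt)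
      (fun p hp => (hball (z.1, p) ⟨hz1, hp⟩).2) (Metric.mem_ball_self hδ) hz2
    refine this.trans ?_
    gcongr
    exact norm_snd_le (z - (x₀, p₀))
  rw [hasFDerivAt_iff_isLittleO]
  refine (h1.add h2).congr_left fun z => ?_
  simp only [ContinuousLinearMap.coprod_apply, Prod.fst_sub, Prod.snd_sub]
  abel

variable {σ l N : ℝ} {ω : E n → E n} {g : E n → ℝ → E n → ℝ}

/-- The derivative in `p₀` of `g(θ + s ω(p₀), t + s; p₀)`. -/
noncomputable def dpFlow (ω : E n → E n) (g : E n → ℝ → E n → ℝ) (θ : E n) (t : ℝ) (p : E n)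
    (s : ℝ) : E n →L[ℝ] ℝ :=
  s • (dθ g (θ + s • ω p) (t + s) p).comp (fderiv ℝ ω p) + dp g (θ + s • ω p) (t + s) p

theorem differentiable_theta (hσ : 1 ≤ σ) (hg : MemB σ g) {t : ℝ} (ht : 0 ≤ t) {p : E n}
    (hp : p ∈ B34 n) : Differentiable ℝ fun θ => g θ t p :=
  (hg.holder t ht p hp).1.differentiable (by
    have : 1 ≤ ⌊σ⌋₊ := Nat.le_floor (by simpa using hσ)
    exact_mod_cast (by omega : ⌊σ⌋₊ ≠ 0))

theorem hasFDerivAt_flow (hσ : 1 ≤ σ) (hω : ContDiffOn ℝ 1 ω (B34 n)) (hg : MemB σ g) (θ : E n)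
    {t s : ℝ} (ht : 0 ≤ t) (hs : 0 ≤ s) {p : E n} (hp : p ∈ B34 n) :
    HasFDerivAt (fun q => g (θ + s • ω q) (t + s) q) (dpFlow ω g θ t p s) p := by
  have hts : 0 ≤ t + s := add_nonneg ht hs
  have hω' : HasFDerivAt ω (fderiv ℝ ω p) p :=
    ((hω.differentiableOn one_ne_zero).differentiableAt (isOpen_B34.mem_nhds hp)).hasFDerivAt
  have h1 : HasFDerivAt (fun z : E n × E n => g z.1 (t + s) z.2)
      ((dθ g (θ + s • ω p) (t + s) p).coprod (dp g (θ + s • ω p) (t + s) p)) (θ + s • ω p, p) := by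
    refine hasFDerivAt_uncurry_of_continuousAt_snd (f := fun x q => g x (t + s) q)
      (D := fun x q => dp g x (t + s) q)
      (differentiable_theta hσ hg hts hp _).hasFDerivAt ?_ ?_
    · have : ∀ᶠ z : E n × E n in 𝓝 (θ + s • ω p, p), z.2 ∈ B34 n :=
        continuous_snd.continuousAt.eventually (isOpen_B34.mem_nhds hp)
      filter_upwards [this] with z hz
      exact (hg.differentiable z.1 (t + s) hts z.2 hz).hasFDerivAt
    · have h : ContinuousOn (fun z : E n × E n => dp g z.1 (t + s) z.2) (univ ×ˢ B34 n) :=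
        hg.continuous_dp.comp (f := fun z : E n × E n => (z.1, t + s, z.2)) (by fun_prop)
          fun z hz => mem_dom.2 ⟨hts, hz.2⟩
      exact h.continuousAt ((isOpen_univ.prod isOpen_B34).mem_nhds ⟨mem_univ _, hp⟩)
  have h2 : HasFDerivAt (fun q => (θ + s • ω q, q))
      ((s • fderiv ℝ ω p).prod (ContinuousLinearMap.id ℝ (E n))) p :=
    ((hω'.const_smul s).const_add θ).prodMk (hasFDerivAt_id p)
  have h3 := h1.comp (f := fun q => (θ + s • ω q, q)) p h2
  convert! h3 using 1
  ext v
  simp [dpFlow]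

theorem norm_dpFlow_le (hσ : 1 ≤ σ) (hb : WeightedBound σ (l + 1) N g) (θ : E n) {t s M : ℝ}
    (ht : 0 ≤ t) (hs : 0 ≤ s) {p : E n} (hp : p ∈ B34 n) (hM : ‖fderiv ℝ ω p‖ ≤ M) :
    ‖dpFlow ω g θ t p s‖ ≤ N * (n * M + 1) * (1 + (t + s)) ^ (-l) := by
  have hts : 0 ≤ t + s := add_nonneg ht hs
  have hN := hb.nonneg
  have hM0 : 0 ≤ M := (norm_nonneg _).trans hM
  have h1 : ‖dθ g (θ + s • ω p) (t + s) p‖ ≤ n * (N * (1 + (t + s)) ^ (-(l + 1))) :=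
    (hb.holder (t + s) hts p hp).fderiv_le hσ _
  have h2 : ‖dp g (θ + s • ω p) (t + s) p‖ ≤ N * (1 + (t + s)) ^ (-l) := by
    simpa using hb.dp_le (θ + s • ω p) (t + s) hts p hp
  have h3 : s * (1 + (t + s)) ^ (-(l + 1)) ≤ (1 + (t + s)) ^ (-l) := by
    rw [show -l = 1 + -(l + 1) by ring, Real.rpow_add (by linarith), Real.rpow_one]
    gcongr
    linarith
  have h4 : ‖s • (dθ g (θ + s • ω p) (t + s) p).comp (fderiv ℝ ω p)‖ ≤
      N * (n * M) * (1 + (t + s)) ^ (-l) := by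
    rw [norm_smul, Real.norm_of_nonneg hs]
    calc s * ‖(dθ g (θ + s • ω p) (t + s) p).comp (fderiv ℝ ω p)‖
        ≤ s * (n * (N * (1 + (t + s)) ^ (-(l + 1))) * M) := by
          gcongr
          exact (ContinuousLinearMap.opNorm_comp_le _ _).trans (by gcongr)
      _ = N * (n * M) * (s * (1 + (t + s)) ^ (-(l + 1))) := by ring
      _ ≤ _ := by gcongr
  refine (norm_add_le _ _).trans ((add_le_add h4 h2).trans_eq ?_)
  ring

theorem aestronglyMeasurable_dpFlow (hσ : 1 ≤ σ) (hg : MemB σ g) (θ : E n) {t : ℝ} (ht : 0 ≤ t)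
    {p : E n} (hp : p ∈ B34 n) :
    AEStronglyMeasurable (dpFlow ω g θ t p) (volume.restrict (Ioi 0)) := by
  have h1 : AEStronglyMeasurable (fun s => dθ g (θ + s • ω p) (t + s) p)
      (volume.restrict (Ioi 0)) := by
    have := aestronglyMeasurable_fderiv (μ := volume.restrict (Ioi (0 : ℝ))) (x := θ)
      (h := fun s x => g (x + s • ω p) (t + s) p)
      (fun x => aestronglyMeasurable_flow hg.continuous ht hp x (ω p))
      (ae_Ioi fun s hs => (differentiable_theta hσ hg (by linarith) hp).comp
        (differentiable_id.add_const _) θ)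
    refine this.congr (Eventually.of_forall fun s => ?_)
    exact fderiv_comp_add_right (f := fun x => g x (t + s) p) (s • ω p)
  have h2 : AEStronglyMeasurable (fun s => dp g (θ + s • ω p) (t + s) p)
      (volume.restrict (Ioi 0)) := aestronglyMeasurable_flow hg.continuous_dp ht hp θ (ω p)
  have h3 : AEStronglyMeasurable (fun s => (dθ g (θ + s • ω p) (t + s) p).comp (fderiv ℝ ω p))
      (volume.restrict (Ioi 0)) :=
    (ContinuousLinearMap.compL ℝ (E n) (E n) ℝ).flip (fderiv ℝ ω p)
      |>.continuous.comp_aestronglyMeasurable h1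
  exact (aestronglyMeasurable_id.smul h3).add h2

theorem continuousOn_fderiv_omega (hω : ContDiffOn ℝ 1 ω (B34 n)) :
    ContinuousOn (fderiv ℝ ω) (B34 n) :=
  hω.continuousOn_fderiv_of_isOpen isOpen_B34 le_rfl

theorem exists_fderiv_omega_bound (hω : ContDiffOn ℝ 1 ω (B34 n)) {p : E n} (hp : p ∈ B34 n) :
    ∃ M, ∀ᶠ q in 𝓝 p, q ∈ B34 n ∧ ‖fderiv ℝ ω q‖ ≤ M := by
  refine ⟨‖fderiv ℝ ω p‖ + 1, (isOpen_B34.eventually_mem hp).and ?_⟩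
  have := ((continuousOn_fderiv_omega hω).continuousAt (isOpen_B34.mem_nhds hp)).norm
  exact (this.eventually_lt continuousAt_const (lt_add_one _)).mono fun q hq => hq.le

theorem hasFDerivAt_sol (hσ : 1 ≤ σ) (hl : 1 < l) (hω : ContDiffOn ℝ 1 ω (B34 n)) (hg : MemB σ g)
    (hb : WeightedBound σ (l + 1) N g) (θ : E n) {t : ℝ} (ht : 0 ≤ t) {p : E n} (hp : p ∈ B34 n) :
    HasFDerivAt (fun q => sol ω g θ t q) (-∫ s in Ioi (0 : ℝ), dpFlow ω g θ t p s) p := by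
  obtain ⟨M, hM⟩ := exists_fderiv_omega_bound hω hp
  simp only [sol_eq]
  refine HasFDerivAt.fun_neg ?_
  refine hasFDerivAt_integral_of_dominated_of_fderiv_le (F' := fun q s => dpFlow ω g θ t q s)
    (bound := fun s => N * (n * M + 1) * (1 + (t + s)) ^ (-l)) hM ?_
    (integrableOn_flow hl hg hb θ (ω p) ht hp) (aestronglyMeasurable_dpFlow hσ hg θ ht hp) ?_
    ((integrableOn_weight ht hl).const_mul _) ?_
  · exact hM.mono fun q hq => aestronglyMeasurable_flow hg.continuous ht hq.1 θ (ω q)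
  · exact ae_Ioi fun s hs q hq => norm_dpFlow_le hσ hb θ ht hs.le hq.1 hq.2
  · exact ae_Ioi fun s hs q hq => hasFDerivAt_flow hσ hω hg θ ht hs.le hq.1

theorem norm_dp_sol_le (hσ : 1 ≤ σ) (hl : 1 < l) (hω : ContDiffOn ℝ 1 ω (B34 n)) (hg : MemB σ g)
    (hb : WeightedBound σ (l + 1) N g) (θ : E n) {t : ℝ} (ht : 0 ≤ t) {p : E n} (hp : p ∈ B34 n)
    {M : ℝ} (hM : ‖fderiv ℝ ω p‖ ≤ M) :
    ‖dp (sol ω g) θ t p‖ ≤ N * (n * M + 1) / (l - 1) * (1 + t) ^ (-(l - 1)) := by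
  have hI : ∫ s in Ioi (0 : ℝ), N * (n * M + 1) * (1 + (t + s)) ^ (-l) =
      N * (n * M + 1) / (l - 1) * (1 + t) ^ (-(l - 1)) := by
    rw [integral_const_mul, integral_weight ht hl]
    ring
  rw [dp, (hasFDerivAt_sol hσ hl hω hg hb θ ht hp).fderiv, norm_neg, ← hI]
  exact norm_integral_le_of_norm_le ((integrableOn_weight ht hl).const_mul _)
    (ae_Ioi fun s hs => norm_dpFlow_le hσ hb θ ht hs.le hp hM)

theorem memPreB_sol (hσ : 1 ≤ σ) (hl : 1 < l) (hω : ContDiffOn ℝ 1 ω (B34 n)) (hg : MemB σ g)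
    (hb : WeightedBound σ (l + 1) N g) : MemPreB σ (sol ω g) where
  periodic θ _ ht _ hp k := periodic_sol hg θ ht hp k
  continuous := continuousOn_sol hl hω.continuousOn hg hb
  differentiable θ _ ht _ hp := (hasFDerivAt_sol hσ hl hω hg hb θ ht hp).differentiableAt
  holder _ ht _ hp := isHolder_sol hl hg hb ht hp

/-! ### Continuity of the derivative in the parameter -/

theorem continuousOn_dp_sol (hσ : 1 ≤ σ) (hl : 1 < l) (hω : ContDiffOn ℝ 1 ω (B34 n))
    (hg : MemB σ g) (hb : WeightedBound σ (l + 1) N g)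
    (hθ : ContinuousOn (fun z : E n × ℝ × E n => dθ g z.1 z.2.1 z.2.2) (dom n)) :
    ContinuousOn (fun z : E n × ℝ × E n => dp (sol ω g) z.1 z.2.1 z.2.2) (dom n) := by
  have heq : EqOn (fun z : E n × ℝ × E n => dp (sol ω g) z.1 z.2.1 z.2.2)
      (fun z => -∫ s in Ioi (0 : ℝ), dpFlow ω g z.1 z.2.1 z.2.2 s) (dom n) := fun z hz =>
    (hasFDerivAt_sol hσ hl hω hg hb z.1 (mem_dom.1 hz).1 (mem_dom.1 hz).2).fderiv
  refine ContinuousOn.congr (ContinuousOn.neg fun z₀ hz₀ => ?_) heq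
  obtain ⟨M, hM⟩ := exists_fderiv_omega_bound hω (mem_dom.1 hz₀).2
  have hM' : ∀ᶠ z : E n × ℝ × E n in 𝓝[dom n] z₀,
      0 ≤ z.2.1 ∧ z.2.2 ∈ B34 n ∧ ‖fderiv ℝ ω z.2.2‖ ≤ M := by
    have h1 : ∀ᶠ z : E n × ℝ × E n in 𝓝 z₀, z.2.2 ∈ B34 n ∧ ‖fderiv ℝ ω z.2.2‖ ≤ M :=
      (continuous_snd.comp continuous_snd).continuousAt.eventually hM
    filter_upwards [self_mem_nhdsWithin, nhdsWithin_le_nhds h1] with z hz hz'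
    exact ⟨(mem_dom.1 hz).1, hz'⟩
  refine continuousWithinAt_of_dominated
    (bound := fun s => N * (n * M + 1) * (1 + (0 + s)) ^ (-l)) ?_ ?_
    ((integrableOn_weight le_rfl hl).const_mul _) ?_
  · exact hM'.mono fun z hz => aestronglyMeasurable_dpFlow hσ hg z.1 hz.1 hz.2.1
  · refine hM'.mono fun z hz => ae_Ioi fun s hs => ?_
    refine (norm_dpFlow_le hσ hb z.1 hz.1 hs.le hz.2.1 hz.2.2).trans ?_
    have hN := hb.nonneg
    have hM0 : 0 ≤ M := (norm_nonneg _).trans hz.2.2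
    exact mul_le_mul_of_nonneg_left (weight_le_weight_zero hz.1 hs.le (by linarith))
      (by positivity)
  · refine ae_Ioi fun s hs => ?_
    have hf : ContinuousOn (fun z : E n × ℝ × E n => fderiv ℝ ω z.2.2) (dom n) :=
      (continuousOn_fderiv_omega hω).comp (by fun_prop) fun z hz => (mem_dom.1 hz).2
    exact ((((continuousOn_flow hθ hω.continuousOn hs.le).clm_comp hf).const_smul s).add
      (continuousOn_flow hg.continuous_dp hω.continuousOn hs.le)) z₀ hz₀

end HomEq

namespace HomEq

variable {n : ℕ} {σ l N : ℝ} {ω : E n → E n} {g : E n → ℝ → E n → ℝ}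

/-! ### Continuity of `∂_θ g` for `σ > 1` -/

theorem weight_le_one {t a : ℝ} (ht : 0 ≤ t) (ha : 0 ≤ a) : (1 + t) ^ (-a) ≤ 1 :=
  Real.rpow_le_one_of_one_le_of_nonpos (by linarith) (by linarith)

/-- For `σ > 1` the gradient is Hölder continuous with an exponent that depends only on `σ`. -/
theorem HolderBound.exists_exponent (n : ℕ) {σ : ℝ} (hσ : 1 < σ) :
    ∃ α : ℝ, 0 < α ∧ ∀ (f : E n → ℝ) (c : ℝ), ContDiff ℝ (⌊σ⌋₊ : ℕ) f → HolderBound σ c f →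
      ∀ x y, ‖fderiv ℝ f x - fderiv ℝ f y‖ ≤ n * ((n + 1) * c) * ‖x - y‖ ^ α := by
  have hk : 1 ≤ ⌊σ⌋₊ := Nat.le_floor (by simpa using hσ.le)
  suffices H : ∃ α : ℝ, 0 < α ∧ ∀ (f : E n → ℝ) (c : ℝ), ContDiff ℝ (⌊σ⌋₊ : ℕ) f →
      HolderBound σ c f → ∀ x y (j : Fin n), ‖(fderiv ℝ f x - fderiv ℝ f y) (stdVec j)‖ ≤
        ((n + 1) * c) * ‖x - y‖ ^ α by
    obtain ⟨α, hα, H⟩ := H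
    refine ⟨α, hα, fun f c hf hb x y => ?_⟩
    have := hb.nonneg
    rw [mul_assoc]
    exact clm_norm_le (by positivity) (H f c hf hb x y)
  rcases hk.eq_or_lt with hk | hk
  · have hne : (⌊σ⌋₊ : ℝ) ≠ σ := by rw [← hk]; simpa using hσ.ne
    refine ⟨σ - 1, by linarith, fun f c hf hb x y j => ?_⟩
    have hc := hb.nonneg
    have H := hb.holder_le hne
    generalize ⌊σ⌋₊ = k at H hk
    subst hk
    have := H (fun _ => j) x y
    rw [partialDeriv_one, partialDeriv_one, Nat.cast_one] at this
    refine this.trans ?_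
    gcongr
    nlinarith [(Nat.cast_nonneg n : (0 : ℝ) ≤ n)]
  · refine ⟨1, one_pos, fun f c hf hb x y j => ?_⟩
    have hc := hb.nonneg
    have hf2 : ContDiff ℝ (1 + 1 : ℕ) f := hf.of_le (by exact_mod_cast hk)
    have hd : Differentiable ℝ fun z => fderiv ℝ f z (stdVec j) :=
      ((hf2.fderiv_right (m := (1 : ℕ)) (by norm_cast)).clm_apply contDiff_const).differentiable
        (by simp)
    have hbd : ∀ z, ‖fderiv ℝ (fun z => fderiv ℝ f z (stdVec j)) z‖ ≤ n * c := fun z => by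
      refine clm_norm_le hc fun i => ?_
      rw [← partialDeriv_one (fun _ => i), partialDeriv_snoc hf2 le_rfl]
      exact hb.partial_le _ hk _ _
    have := convex_univ.norm_image_sub_le_of_norm_fderiv_le (𝕜 := ℝ) (fun z _ => hd z)
      (fun z _ => hbd z) (mem_univ y) (mem_univ x)
    rw [sub_apply, Real.rpow_one]
    refine this.trans ?_
    gcongr
    linarith

theorem norm_diffQuotient_sub_le {f : E n → ℝ} (hf : Differentiable ℝ f) {C α : ℝ} (hC : 0 ≤ C)
    (hα : 0 < α) (h : ∀ x y, ‖fderiv ℝ f x - fderiv ℝ f y‖ ≤ C * ‖x - y‖ ^ α) (x : E n)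
    (j : Fin n) {r : ℝ} (hr : 0 < r) :
    ‖fderiv ℝ f x (stdVec j) - r⁻¹ * (f (x + r • stdVec j) - f x)‖ ≤ C * r ^ α := by
  have h1 := (convex_closedBall x r).norm_image_sub_le_of_norm_hasFDerivWithin_le' (f := f)
    (f' := fderiv ℝ f) (φ := fderiv ℝ f x) (C := C * r ^ α) (x := x) (y := x + r • stdVec j)
    (fun y _ => (hf y).hasFDerivAt.hasFDerivWithinAt)
    (fun y hy => (h y x).trans (by
      rw [Metric.mem_closedBall, dist_eq_norm] at hy
      gcongr)) (Metric.mem_closedBall_self hr.le)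
    (by simp [norm_smul, abs_of_pos hr])
  rw [add_sub_cancel_left, norm_smul, map_smul, smul_eq_mul, Real.norm_of_nonneg hr.le,
    PiLp.norm_single, norm_one, mul_one] at h1
  have h2 : fderiv ℝ f x (stdVec j) - r⁻¹ * (f (x + r • stdVec j) - f x) =
      -(r⁻¹ * (f (x + r • stdVec j) - f x - r * fderiv ℝ f x (stdVec j))) := by
    field_simp
    ring
  rw [h2, norm_neg, norm_mul, norm_inv, Real.norm_of_nonneg hr.le, inv_mul_le_iff₀ hr]
  linarith

theorem continuousOn_dtheta (hσ : 1 < σ) (hl : 1 < l) (hg : MemB σ g)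
    (hb : WeightedBound σ (l + 1) N g) :
    ContinuousOn (fun z : E n × ℝ × E n => dθ g z.1 z.2.1 z.2.2) (dom n) := by
  obtain ⟨α, hα, H⟩ := HolderBound.exists_exponent n hσ
  have hN := hb.nonneg
  set C : ℝ := n * ((n + 1) * N) with hC
  have hmod : ∀ t, 0 ≤ t → ∀ p ∈ B34 n, ∀ x y,
      ‖fderiv ℝ (fun θ => g θ t p) x - fderiv ℝ (fun θ => g θ t p) y‖ ≤ C * ‖x - y‖ ^ α := by
    intro t ht p hp x y
    refine (H _ _ (hg.holder t ht p hp).1 (hb.holder t ht p hp) x y).trans ?_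
    have := weight_le_one (a := l + 1) ht (by linarith)
    rw [hC]
    gcongr
    exact mul_le_of_le_one_right hN this
  have hpart : ∀ j : Fin n, ContinuousOn
      (fun z : E n × ℝ × E n => dθ g z.1 z.2.1 z.2.2 (stdVec j)) (dom n) := by
    intro j
    refine TendstoUniformlyOn.continuousOn (p := atTop) (F := fun (m : ℕ) (z : E n × ℝ × E n) =>
      (((m : ℝ) + 1)⁻¹)⁻¹ * (g (z.1 + ((m : ℝ) + 1)⁻¹ • stdVec j) z.2.1 z.2.2 - g z.1 z.2.1 z.2.2))
      ?_ (Frequently.of_forall fun m => ?_)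
    · rw [Metric.tendstoUniformlyOn_iff]
      intro ε hε
      have hlim : Tendsto (fun m : ℕ => C * (((m : ℝ) + 1)⁻¹) ^ α) atTop (𝓝 0) := by
        have h0 : Tendsto (fun m : ℕ => ((m : ℝ) + 1)⁻¹) atTop (𝓝 0) := by
          simpa [one_div] using tendsto_one_div_add_atTop_nhds_zero_nat (𝕜 := ℝ)
        have := (h0.rpow_const (p := α) (Or.inr hα.le)).const_mul C
        simpa [Real.zero_rpow hα.ne'] using this
      filter_upwards [hlim.eventually_lt_const hε] with m hm z hz
      rw [mem_dom] at hz
      rw [dist_eq_norm]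
      exact (norm_diffQuotient_sub_le (differentiable_theta hσ.le hg hz.1 hz.2) (by positivity) hα
        (hmod _ hz.1 _ hz.2) z.1 j (by positivity)).trans_lt hm
    · refine ContinuousOn.mul continuousOn_const (ContinuousOn.sub ?_ hg.continuous)
      exact hg.continuous.comp
        (f := fun z : E n × ℝ × E n => (z.1 + ((m : ℝ) + 1)⁻¹ • stdVec j, z.2.1, z.2.2))
        (by fun_prop) fun z hz => mem_dom.2 (mem_dom.1 hz)
  have : (fun z : E n × ℝ × E n => dθ g z.1 z.2.1 z.2.2) = fun z => ∑ j,
      dθ g z.1 z.2.1 z.2.2 (stdVec j) • (EuclideanSpace.proj j : E n →L[ℝ] ℝ) := by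
    ext1 z; exact clm_eq_sum _
  rw [this]
  exact continuousOn_finsetSum _ fun j _ => (hpart j).smul continuousOn_const

/-! ### The homological equation -/

theorem sol_eq_add_intervalIntegral (hl : 1 < l) (hg : MemB σ g) (hb : WeightedBound σ (l + 1) N g)
    (θ : E n) {t s : ℝ} (ht : 0 ≤ t) (hs : 0 ≤ s) {p : E n} (hp : p ∈ B34 n) :
    IntervalIntegrable (fun τ => g (θ + (τ - s) • ω p) τ p) volume t s ∧
    sol ω g θ s p = sol ω g (θ - (s - t) • ω p) t p + ∫ τ in t..s, g (θ + (τ - s) • ω p) τ p := by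
  have he : ∀ τ, θ - (s - t) • ω p + (τ - t) • ω p = θ + (τ - s) • ω p := fun τ => by module
  have h1 : IntegrableOn (fun τ => g (θ + (τ - s) • ω p) τ p) (Ioi s) :=
    (integrableOn_shift_iff θ (ω p) s p).2 (integrableOn_flow hl hg hb θ (ω p) hs hp)
  have h2 : IntegrableOn (fun τ => g (θ + (τ - s) • ω p) τ p) (Ioi t) := by
    have := (integrableOn_shift_iff (θ - (s - t) • ω p) (ω p) t p).2
      (integrableOn_flow hl hg hb _ (ω p) ht hp)
    simpa only [he] using this
  refine ⟨⟨h2.mono_set Ioc_subset_Ioi_self, h1.mono_set Ioc_subset_Ioi_self⟩, ?_⟩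
  have h3 := intervalIntegral.integral_interval_add_Ioi h2 h1
  simp only [sol, he]
  linarith

theorem hasDerivWithinAt_intervalIntegral_flow (hg : ContinuousOn
      (fun z : E n × ℝ × E n => g z.1 z.2.1 z.2.2) (dom n))
    (θ v : E n) {t : ℝ} (ht : 0 ≤ t) {p : E n} (hp : p ∈ B34 n)
    (hint : ∀ s, 0 ≤ s → IntervalIntegrable (fun τ => g (θ + (τ - s) • v) τ p) volume t s) :
    HasDerivWithinAt (fun s => ∫ τ in t..s, g (θ + (τ - s) • v) τ p) (g θ t p) (Ici 0) t := by
  rw [hasDerivWithinAt_iff_isLittleO, Asymptotics.isLittleO_iff]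
  intro ε hε
  have hc : ContinuousOn (fun q : ℝ × ℝ => g (θ + (q.2 - q.1) • v) q.2 p) (univ ×ˢ Ici 0) :=
    hg.comp (f := fun q : ℝ × ℝ => (θ + (q.2 - q.1) • v, q.2, p)) (by fun_prop)
      fun q hq => mem_dom.2 ⟨hq.2, hp⟩
  obtain ⟨δ, hδ, hball⟩ := Metric.continuousWithinAt_iff.1 (hc (t, t) ⟨mem_univ _, ht⟩) ε hε
  filter_upwards [self_mem_nhdsWithin, nhdsWithin_le_nhds (Metric.ball_mem_nhds t hδ)] with s hs hst
  have hs' : 0 ≤ s := hs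
  rw [Metric.mem_ball, Real.dist_eq] at hst
  have hsub : (∫ τ in t..s, g (θ + (τ - s) • v) τ p) - (s - t) • g θ t p =
      ∫ τ in t..s, (g (θ + (τ - s) • v) τ p - g θ t p) := by
    rw [intervalIntegral.integral_sub (hint s hs') intervalIntegrable_const,
      intervalIntegral.integral_const]
  rw [intervalIntegral.integral_same, sub_zero, hsub]
  refine intervalIntegral.norm_integral_le_of_norm_le_const fun τ hτ => ?_
  have hτ0 : 0 ≤ τ := (le_min ht hs').trans hτ.1.le
  have hτt : |τ - t| < δ := by
    refine lt_of_le_of_lt ?_ hst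
    have := abs_sub_left_of_mem_uIcc (uIoc_subset_uIcc hτ)
    exact this
  have h := hball (x := (s, τ)) ⟨mem_univ _, hτ0⟩ (by
    rw [Prod.dist_eq, max_lt_iff, Real.dist_eq, Real.dist_eq]
    exact ⟨hst, hτt⟩)
  rw [dist_eq_norm] at h
  simpa using h.le

theorem isSolution_sol (hσ : 1 ≤ σ) (hl : 1 < l) (hg : MemB σ g)
    (hb : WeightedBound σ (l + 1) N g) : IsSolution ω g (sol ω g) := by
  intro θ t ht p hp
  have hd : DifferentiableAt ℝ (fun θ' => sol ω g θ' t p) θ :=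
    (contDiff_sol hl hg hb ht hp).1.differentiable (by
      have : 1 ≤ ⌊σ⌋₊ := Nat.le_floor (by simpa using hσ)
      exact_mod_cast (by omega : ⌊σ⌋₊ ≠ 0)) θ
  refine ⟨hd, -dθ (sol ω g) θ t p (ω p) + g θ t p, ?_, by ring⟩
  have h1 : HasDerivAt (fun s : ℝ => θ - (s - t) • ω p) (-ω p) t := by
    have := (((hasDerivAt_id t).sub_const t).smul_const (ω p)).const_sub θ
    simpa using this
  have h2 : HasDerivAt (fun s : ℝ => sol ω g (θ - (s - t) • ω p) t p)
      (-dθ (sol ω g) θ t p (ω p)) t := by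
    have h0 : HasFDerivAt (fun θ' => sol ω g θ' t p) (dθ (sol ω g) θ t p)
        (θ - (t - t) • ω p) := by
      rw [sub_self, zero_smul, sub_zero]
      exact hd.hasFDerivAt
    rw [← map_neg]
    exact h0.comp_hasDerivAt t h1
  have h3 := hasDerivWithinAt_intervalIntegral_flow hg.continuous θ (ω p) ht hp
    fun s hs => (sol_eq_add_intervalIntegral hl hg hb θ ht hs hp).1
  exact (h2.hasDerivWithinAt.add h3).congr
    (fun s hs => (sol_eq_add_intervalIntegral hl hg hb θ ht hs hp).2)
    (sol_eq_add_intervalIntegral hl hg hb θ ht ht hp).2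

end HomEq

namespace HomEq

variable {n : ℕ} {σ l N : ℝ} {ω : E n → E n} {g : E n → ℝ → E n → ℝ}

/-! ### Uniqueness by a maximum principle -/

/-- The closed unit cube, which contains a representative of every point of the torus. -/
def unitCube (n : ℕ) : Set (E n) := {θ | ∀ i, θ i ∈ Icc (0 : ℝ) 1}

theorem isCompact_unitCube : IsCompact (unitCube n) := by
  have h : IsCompact (Set.pi univ fun _ : Fin n => Icc (0 : ℝ) 1) :=
    isCompact_univ_pi fun _ => isCompact_Icc
  have h2 := h.image (PiLp.continuous_toLp 2 fun _ : Fin n => ℝ)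
  convert h2 using 1
  ext θ
  constructor
  · intro hθ
    exact ⟨WithLp.ofLp θ, fun i _ => hθ i, rfl⟩
  · rintro ⟨x, hx, rfl⟩ i
    exact hx i (mem_univ i)

theorem exists_unitCube_add_latt (θ : E n) : ∃ θ' ∈ unitCube n, ∃ k : Fin n → ℤ,
    θ = θ' + latt k := by
  refine ⟨WithLp.toLp 2 fun i => Int.fract (θ i), fun i => ⟨Int.fract_nonneg _,
    (Int.fract_lt_one _).le⟩, fun i => ⌊θ i⌋, ?_⟩
  ext i
  simp [latt, Int.fract_add_floor]

theorem transport_nonpos {u : E n → ℝ → ℝ} {v : E n}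
    (hc : ContinuousOn (fun z : E n × ℝ => u z.1 z.2) (univ ×ˢ Ici 0))
    (hper : ∀ θ t, 0 ≤ t → ∀ k : Fin n → ℤ, u (θ + latt k) t = u θ t)
    (hu : ∀ θ t, 0 ≤ t → ∃ d, HasDerivWithinAt (fun s => u θ s) d (Ici 0) t ∧
      fderiv ℝ (fun θ' => u θ' t) θ v + d = 0)
    (hlim : ∀ ε > 0, ∀ᶠ t in atTop, ∀ θ, u θ t ≤ ε) (θ : E n) {t : ℝ} (ht : 0 ≤ t) :
    u θ t ≤ 0 := by
  set f : ℝ → E n → ℝ := fun s x => u x (max s 0) with hf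
  have hfc : Continuous (fun z : ℝ × E n => f z.1 z.2) :=
    hc.comp_continuous (f := fun z : ℝ × E n => (z.2, max z.1 0)) (by fun_prop)
      fun z => ⟨mem_univ _, mem_Ici.2 (le_max_right _ _)⟩
  set M : ℝ → ℝ := fun s => sSup (f s '' unitCube n) with hM
  have hMc : Continuous M := isCompact_unitCube.continuous_sSup hfc
  have hbdd : ∀ s, BddAbove (f s '' unitCube n) := fun s =>
    (isCompact_unitCube.image (hfc.comp (Continuous.prodMk_right s))).bddAbove
  have hle : ∀ s, 0 ≤ s → ∀ x, u x s ≤ M s := by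
    intro s hs x
    obtain ⟨x', hx', k, rfl⟩ := exists_unitCube_add_latt x
    rw [hper x' s hs k]
    refine le_csSup (hbdd s) ⟨x', hx', ?_⟩
    simp [hf, max_eq_left hs]
  have hne : (unitCube n).Nonempty := ⟨0, fun i => by simp⟩
  have hmax : ∀ s, 0 ≤ s → ∃ x, M s = u x s := by
    intro s hs
    obtain ⟨x, -, hx⟩ := isCompact_unitCube.exists_sSup_image_eq hne
      (hfc.comp (Continuous.prodMk_right s)).continuousOn
    refine ⟨x, hx.trans ?_⟩
    simp [hf, max_eq_left hs]
  have hmono : ∀ b, t ≤ b → M t ≤ M b := by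
    intro b hb
    have key := image_le_of_liminf_slope_right_le_deriv_boundary (f := fun s => -M s) (a := t)
      (b := b) hMc.neg.continuousOn (B := fun _ => -M t) (B' := fun _ => 0) le_rfl
      continuousOn_const (fun x _ => hasDerivWithinAt_const x _ _) ?_ (right_mem_Icc.2 hb)
    · linarith
    intro s hs r hr
    have hs0 : 0 ≤ s := ht.trans hs.1
    obtain ⟨x, hx⟩ := hmax s hs0
    obtain ⟨d, hd, hd0⟩ := hu x s hs0
    have hext : IsLocalMax (fun θ' => u θ' s) x :=
      Eventually.of_forall fun y => (hle s hs0 y).trans_eq hx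
    rw [hext.fderiv_eq_zero, zero_apply, zero_add] at hd0
    subst hd0
    have hd' : HasDerivWithinAt (fun s => -u x s) (-0) (Ioi s) s :=
      (hd.mono fun y hy => hs0.trans (le_of_lt hy)).fun_neg
    have hslope := (hasDerivWithinAt_iff_tendsto_slope' (by simp)).1 hd'
    rw [neg_zero] at hslope
    refine Eventually.frequently ?_
    filter_upwards [hslope.eventually_lt_const hr, self_mem_nhdsWithin] with z hz hzs
    refine lt_of_le_of_lt ?_ hz
    have hzs' : 0 < z - s := sub_pos.2 hzs
    rw [slope_def_field, slope_def_field]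
    have := hle z (hs0.trans (le_of_lt hzs)) x
    gcongr
    linarith
  refine le_of_forall_pos_le_add fun ε hε => ?_
  obtain ⟨b, hb, htb⟩ := ((hlim ε hε).and (eventually_ge_atTop t)).exists
  obtain ⟨x, hx⟩ := hmax b (ht.trans htb)
  rw [zero_add]
  exact (hle t ht θ).trans ((hmono b htb).trans (hx.le.trans (hb x)))

theorem Decays.eventually_le {κ : E n → ℝ → E n → ℝ} (h : Decays κ) {p : E n} (hp : p ∈ B34 n)
    {ε : ℝ} (hε : 0 < ε) : ∀ᶠ t in atTop, ∀ θ, |κ θ t p| ≤ ε := by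
  filter_upwards [(h p hp).eventually_lt_const (ENNReal.ofReal_pos.2 hε)] with t ht θ
  have := (le_iSup (fun θ => ‖κ θ t p‖ₑ) θ).trans ht.le
  rw [← ofReal_norm, ENNReal.ofReal_le_ofReal_iff hε.le] at this
  exact this

theorem solution_le {κ₁ κ₂ : E n → ℝ → E n → ℝ} (h₁ : MemPreB σ κ₁) (h₂ : MemPreB σ κ₂)
    (hs₁ : IsSolution ω g κ₁) (hs₂ : IsSolution ω g κ₂) (hd₁ : Decays κ₁) (hd₂ : Decays κ₂)
    (θ : E n) {t : ℝ} (ht : 0 ≤ t) {p : E n} (hp : p ∈ B34 n) : κ₁ θ t p ≤ κ₂ θ t p := by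
  have hcont : ∀ κ : E n → ℝ → E n → ℝ, MemPreB σ κ →
      ContinuousOn (fun z : E n × ℝ => κ z.1 z.2 p) (univ ×ˢ Ici 0) := fun κ h =>
    h.continuous.comp (f := fun z : E n × ℝ => (z.1, z.2, p)) (by fun_prop)
      fun z hz => mem_dom.2 ⟨hz.2, hp⟩
  have := transport_nonpos (u := fun θ t => κ₁ θ t p - κ₂ θ t p) (v := ω p)
    ((hcont κ₁ h₁).sub (hcont κ₂ h₂)) ?_ ?_ ?_ θ ht
  · linarith
  · intro θ t ht k
    simp only [h₁.periodic θ t ht p hp k, h₂.periodic θ t ht p hp k]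
  · intro θ t ht
    obtain ⟨hθ₁, d₁, hd₁, he₁⟩ := hs₁ θ t ht p hp
    obtain ⟨hθ₂, d₂, hd₂, he₂⟩ := hs₂ θ t ht p hp
    refine ⟨d₁ - d₂, hd₁.fun_sub hd₂, ?_⟩
    rw [fderiv_fun_sub hθ₁ hθ₂, sub_apply]
    simp only [dθ] at he₁ he₂
    linarith
  · intro ε hε
    filter_upwards [hd₁.eventually_le hp (half_pos hε), hd₂.eventually_le hp (half_pos hε)]
      with t h1 h2 θ
    have := (abs_le.1 (h1 θ)).2
    have := (abs_le.1 (h2 θ)).1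
    linarith

/-! ### The weighted estimate -/

theorem wNorm_sol_le (hσ : 1 ≤ σ) (hl : 1 < l) (hω : ContDiffOn ℝ 1 ω (B34 n)) (hg : MemB σ g)
    (hb : WeightedBound σ (l + 1) N g) (hω' : cNorm 1 (B34 n) ω < ⊤) :
    wNorm σ l (sol ω g) ≤ ENNReal.ofReal
      ((4 / l + 2 * (n * (n * (cNorm 1 (B34 n) ω).toReal) + 1) / (l - 1)) * N) := by
  have hN := hb.nonneg
  have hl0 : 0 < l - 1 := by linarith
  refine (wNorm_le_of_bounds (N₁ := N / l)
    (N₂ := N * (n * (n * (cNorm 1 (B34 n) ω).toReal) + 1) / (l - 1)) hl.le (by positivity)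
    (by positivity) (fun t ht p hp => (contDiff_sol hl hg hb ht hp).2)
    (fun θ t ht p hp => norm_dp_sol_le hσ hl hω hg hb θ ht hp
      (fderiv_norm_le_cNorm hω' hp))).trans_eq ?_
  congr 1
  ring

end HomEq

open HomEq
theorem homological_equation_estimate (n : ℕ) (l : ℝ) (hl : 1 < l) :
    ∃ C : ℝ≥0 → ℝ≥0, ∀ (σ : ℝ) (ω : E n → E n) (g : E n → ℝ → E n → ℝ),
      1 ≤ σ →
      ContDiffOn ℝ 1 ω (B34 n) →
      MemB σ g →
      wNorm σ (l + 1) g < ⊤ →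
      -- the integral converges absolutely
      (∀ θ : E n, ∀ t : ℝ, 0 ≤ t → ∀ p ∈ B34 n,
        IntegrableOn (fun τ => g (θ + (τ - t) • ω p) τ p) (Ioi t)) ∧
      -- it is a solution with the asymptotic condition
      MemPreB σ (sol ω g) ∧
      IsSolution ω g (sol ω g) ∧
      Decays (sol ω g) ∧
      -- it lies in the space `B⁺_σ`; for `σ = 1` this needs `∂_θ g` to be continuous
      (1 < σ ∨ ContinuousOn (fun z : E n × ℝ × E n => dθ g z.1 z.2.1 z.2.2) (dom n) →
        MemB σ (sol ω g)) ∧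
      -- it is the only solution
      (∀ κ : E n → ℝ → E n → ℝ, MemPreB σ κ → IsSolution ω g κ → Decays κ →
        ∀ θ : E n, ∀ t : ℝ, 0 ≤ t → ∀ p ∈ B34 n, κ θ t p = sol ω g θ t p) ∧
      -- the estimate
      (cNorm 1 (B34 n) ω < ⊤ →
        wNorm σ l (sol ω g) ≤ (C (cNorm 1 (B34 n) ω).toNNReal : ℝ≥0∞) * wNorm σ (l + 1) g) := by
  refine ⟨fun w => Real.toNNReal
    ((4 / l + 2 * (n * (n * (w : ℝ)) + 1) / (l - 1)) * 2 ^ l), fun σ ω g hσ hω hg hw => ?_⟩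
  have hb := weightedBound_of_wNorm_lt_top (by linarith : 2 ≤ l + 1) hw
  rw [add_sub_cancel_right] at hb
  have hpre := memPreB_sol hσ hl hω hg hb
  have hsol := isSolution_sol (ω := ω) hσ hl hg hb
  have hdec := decays_sol (ω := ω) hl hg hb
  refine ⟨fun θ t ht p hp => (integrableOn_shift_iff θ (ω p) t p).2
    (integrableOn_flow hl hg hb θ (ω p) ht hp), hpre, hsol, hdec, fun h => ⟨hpre, ?_⟩, ?_, ?_⟩
  · exact continuousOn_dp_sol hσ hl hω hg hb (h.elim (fun h => continuousOn_dtheta h hl hg hb) id)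
  · intro κ hκ hκs hκd θ t ht p hp
    exact le_antisymm (solution_le hκ hpre hκs hsol hκd hdec θ ht hp)
      (solution_le hpre hκ hsol hκs hdec hκd θ ht hp)
  · intro hω'
    have hl0 : 0 < l - 1 := by linarith
    refine (wNorm_sol_le hσ hl hω hg hb hω').trans_eq ?_
    rw [← mul_assoc, ENNReal.ofReal_mul (by positivity), ENNReal.ofReal_toReal hw.ne]
    rfl
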